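/- Let (x_j)_{j=1}^∞ be points in 𝕋^d and (r_j)_{j=1}^∞ positive radii with r_j → 0, and suppose that the set E = limsup_{j→∞} B(x_j,r_j) has full Lebesgue measure. Then for any 0 ≤ s ≤ d, the set E_U = limsup_{j→∞} B(x_j, r_j^{d/s}) belongs to the class 𝒢^s(𝕋^d) of sets with large intersections. -/

import Mathlib

open MeasureTheory Metric Filter Set
open scoped ENNReal Topology

noncomputable section

/-- The `d`-dimensional torus `ℝ^d / ℤ^d`. -/
abbrev Torus (d : ℕ) := Fin d → AddCircle (1 : ℝ)

/-- The canonical projection `ℝ^d → 𝕋^d`. -/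
def torusProj {d : ℕ} (y : Fin d → ℝ) : Torus d := fun i => (y i : AddCircle (1 : ℝ))

/-- A dyadic cube in the torus: the image under the projection `ℝ^d → 𝕋^d` of a product
of intervals `[kᵢ 2^{-n}, (kᵢ+1) 2^{-n})`. -/
def IsDyadicCube {d : ℕ} (D : Set (Torus d)) : Prop :=
  ∃ (n : ℕ) (k : Fin d → ℤ),
    D = torusProj ''
      (Set.univ.pi fun i => Set.Ico ((k i : ℝ) / 2 ^ n) (((k i : ℝ) + 1) / 2 ^ n))

/-- The outer dyadic content `ℳ_∞^t(E) = inf { Σ_k |D_k|^t : E ⊆ ⋃_k D_k, D_k dyadic }`. -/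
noncomputable def dyadicContent {d : ℕ} (t : ℝ) (E : Set (Torus d)) : ℝ≥0∞ :=
  ⨅ (f : ℕ → Set (Torus d)) (_ : ∀ n, IsDyadicCube (f n)) (_ : E ⊆ ⋃ n, f n),
    ∑' n, EMetric.diam (f n) ^ t

/-- Falconer's class `𝒢^s(𝕋^d)` of sets with large intersections: `G_δ` sets `E` with
`ℳ_∞^t(E ∩ D) ≥ |D|^t` for all dyadic cubes `D` and all `t < s`. -/
def MemLargeIntersectionClass {d : ℕ} (s : ℝ) (E : Set (Torus d)) : Prop :=
  IsGδ E ∧ ∀ D : Set (Torus d), IsDyadicCube D → ∀ t : ℝ, t < s →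
    EMetric.diam D ^ t ≤ dyadicContent t (E ∩ D)

/-- The index of the dyadic arc of length `2^{-n}` containing a point of the circle. -/
def arcIndex (n : ℕ) (a : AddCircle (1 : ℝ)) : ℤ :=
  ⌊(AddCircle.equivIco 1 0 a : ℝ) * 2 ^ n⌋

/-- The dyadic cube of side `2^{-n}` containing the point `p` of the torus. -/
def cube {d : ℕ} (n : ℕ) (p : Torus d) : Set (Torus d) :=
  Set.univ.pi fun i => {a | arcIndex n a = arcIndex n (p i)}

theorem arcIndex_coe (n : ℕ) (y : ℝ) :
    arcIndex n (y : AddCircle (1 : ℝ)) = ⌊y * 2 ^ n⌋ % 2 ^ n := by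
  have h : (AddCircle.equivIco 1 0 (y : AddCircle (1 : ℝ)) : ℝ) = Int.fract y := by
    simp
  have h2 : ⌊y * 2 ^ n⌋ / 2 ^ n = ⌊y⌋ := by
    have := Int.mul_natCast_floor_div_cancel (n := 2 ^ n) (by positivity) y
    simpa using this
  have h3 : Int.fract y * 2 ^ n = y * 2 ^ n - ((⌊y⌋ * 2 ^ n : ℤ) : ℝ) := by
    rw [Int.fract]; push_cast; ring
  rw [arcIndex, h, h3, Int.floor_sub_intCast, Int.emod_def, h2, mul_comm (2 ^ n : ℤ)]

theorem exists_lift (a : AddCircle (1 : ℝ)) : ∃ y ∈ Ico (0 : ℝ) 1, (y : AddCircle (1 : ℝ)) = a :=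
  ⟨AddCircle.equivIco 1 0 a, ⟨(AddCircle.equivIco 1 0 a).2.1,
    (AddCircle.equivIco 1 0 a).2.2.trans_eq (zero_add 1)⟩, AddCircle.coe_equivIco⟩

theorem floor_mul_two_pow_mod {n : ℕ} {y : ℝ} (hy : y ∈ Ico (0 : ℝ) 1) :
    ⌊y * 2 ^ n⌋ % 2 ^ n = ⌊y * 2 ^ n⌋ := by
  have h2 : (0 : ℝ) < 2 ^ n := by positivity
  refine Int.emod_eq_of_lt (Int.floor_nonneg.2 (mul_nonneg hy.1 h2.le)) ?_
  rw [Int.floor_lt]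
  push_cast
  nlinarith [hy.2]

theorem floor_mul_two_pow_eq_iff {n : ℕ} {y : ℝ} {k : ℤ} :
    ⌊y * 2 ^ n⌋ = k ↔ y ∈ Ico ((k : ℝ) / 2 ^ n) (((k : ℝ) + 1) / 2 ^ n) := by
  have h2 : (0 : ℝ) < 2 ^ n := by positivity
  rw [Int.floor_eq_iff, mem_Ico, div_le_iff₀ h2, lt_div_iff₀ h2]

theorem arcIndex_of_le {m n : ℕ} (h : m ≤ n) {a b : AddCircle (1 : ℝ)}
    (hab : arcIndex n a = arcIndex n b) : arcIndex m a = arcIndex m b := by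
  obtain ⟨l, rfl⟩ := Nat.exists_eq_add_of_le h
  have key : ∀ c : AddCircle (1 : ℝ), arcIndex m c = arcIndex (m + l) c / 2 ^ l := by
    intro c
    have := Int.mul_natCast_floor_div_cancel (n := 2 ^ l) (by positivity)
      ((AddCircle.equivIco 1 0 c : ℝ) * 2 ^ m)
    rw [arcIndex, arcIndex, ← this, pow_add, mul_assoc]
    push_cast
    rfl
  rw [key, key, hab]

theorem image_coe_Ico (n : ℕ) (k : ℤ) :
    ((fun y : ℝ => (y : AddCircle (1 : ℝ))) '' Ico ((k : ℝ) / 2 ^ n) (((k : ℝ) + 1) / 2 ^ n)) =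
      {a | arcIndex n a = k % 2 ^ n} := by
  ext a
  constructor
  · rintro ⟨y, hy, rfl⟩
    rw [← floor_mul_two_pow_eq_iff] at hy
    simp [arcIndex_coe, hy]
  · intro ha
    obtain ⟨y, hy, rfl⟩ := exists_lift a
    rw [mem_ofPred_eq, arcIndex_coe, floor_mul_two_pow_mod hy] at ha
    refine ⟨y + (k / 2 ^ n : ℤ), ?_, ?_⟩
    · rw [← floor_mul_two_pow_eq_iff]
      have : (y + (k / 2 ^ n : ℤ)) * 2 ^ n = y * 2 ^ n + ((k / 2 ^ n * 2 ^ n : ℤ) : ℝ) := by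
        push_cast; ring
      rw [this, Int.floor_add_intCast, ha, mul_comm, Int.emod_add_mul_ediv]
    · have : (((k / 2 ^ n : ℤ) : ℝ) : AddCircle (1 : ℝ)) = 0 :=
        (AddCircle.coe_eq_zero_iff (1 : ℝ)).2 ⟨k / 2 ^ n, by simp⟩
      simp only [AddCircle.coe_add, this, add_zero]

theorem arcIndex_emod (n : ℕ) (a : AddCircle (1 : ℝ)) :
    arcIndex n a % 2 ^ n = arcIndex n a := by
  obtain ⟨y, hy, rfl⟩ := exists_lift a
  rw [arcIndex_coe, Int.emod_emod_of_dvd _ dvd_rfl]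

theorem mem_cube {d : ℕ} {n : ℕ} {p q : Torus d} :
    q ∈ cube n p ↔ ∀ i, arcIndex n (q i) = arcIndex n (p i) := by
  simp [cube]

theorem self_mem_cube {d : ℕ} (n : ℕ) (p : Torus d) : p ∈ cube n p := by simp [mem_cube]

theorem cube_subset_cube {d m n : ℕ} (h : m ≤ n) {p q z : Torus d} (hp : z ∈ cube n p)
    (hq : z ∈ cube m q) : cube n p ⊆ cube m q := by
  intro w hw
  rw [mem_cube] at *
  intro i
  rw [← hq i]
  exact arcIndex_of_le h ((hw i).trans (hp i).symm)

theorem IsDyadicCube.exists_eq_cube {d : ℕ} {D : Set (Torus d)} (hD : IsDyadicCube D) :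
    ∃ n p, D = cube n p := by
  obtain ⟨n, k, rfl⟩ := hD
  refine ⟨n, torusProj fun i => (k i : ℝ) / 2 ^ n, ?_⟩
  have h2 : (2 : ℝ) ^ n ≠ 0 := by positivity
  have : (torusProj : (Fin d → ℝ) → Torus d) =
    Pi.map fun _ (y : ℝ) => (y : AddCircle (1 : ℝ)) := rfl
  rw [this, Set.piMap_image_univ_pi, cube]
  congr 1
  ext1 i
  rw [image_coe_Ico]
  simp [arcIndex_coe, h2]

theorem dist_le_of_arcIndex_eq {n : ℕ} {a b : AddCircle (1 : ℝ)}
    (h : arcIndex n a = arcIndex n b) : dist a b ≤ (1 / 2) ^ n := by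
  obtain ⟨y, hy, rfl⟩ := exists_lift a
  obtain ⟨z, hz, rfl⟩ := exists_lift b
  rw [arcIndex_coe, arcIndex_coe, floor_mul_two_pow_mod hy, floor_mul_two_pow_mod hz] at h
  have h1 := Int.abs_sub_lt_one_of_floor_eq_floor h
  have h2 : (0 : ℝ) < 2 ^ n := by positivity
  rw [← sub_mul, abs_mul, abs_of_pos h2] at h1
  rw [dist_eq_norm, ← AddCircle.coe_sub]
  refine (QuotientAddGroup.norm_mk_le_norm (S := AddSubgroup.zmultiples (1 : ℝ))).trans ?_
  rw [one_div_pow, le_div_iff₀ h2, Real.norm_eq_abs]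
  exact h1.le

theorem dist_le_of_mem_cube {d n : ℕ} {p q : Torus d} (h : q ∈ cube n p) :
    dist q p ≤ (1 / 2) ^ n :=
  (dist_pi_le_iff (by positivity)).2 fun i => dist_le_of_arcIndex_eq (mem_cube.1 h i)

theorem ediam_cube_le {d : ℕ} (n : ℕ) (p : Torus d) :
    ediam (cube n p) ≤ ENNReal.ofReal ((1 / 2) ^ n) := by
  refine ediam_le fun x hx y hy => ?_
  rw [edist_dist]
  refine ENNReal.ofReal_le_ofReal (dist_le_of_mem_cube (n := n) ?_)
  rw [mem_cube] at *
  exact fun i => (hx i).trans (hy i).symm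

theorem le_ediam_cube {d : ℕ} (hd : 0 < d) {n : ℕ} (hn : 1 ≤ n) (p : Torus d) :
    ENNReal.ofReal ((1 / 2) ^ n) ≤ ediam (cube n p) := by
  have h2 : (0 : ℝ) < 2 ^ n := by positivity
  have key : ∀ δ ∈ Ico (0 : ℝ) ((1 / 2) ^ n), ENNReal.ofReal δ ≤ ediam (cube n p) := by
    rintro δ ⟨hδ0, hδ⟩
    have hδ' : δ ≤ 1 / 2 := hδ.le.trans (by
      simpa using pow_le_pow_of_le_one (by norm_num : (0:ℝ) ≤ 1 / 2) (by norm_num) hn)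
    set u : ℝ → Torus d := fun t i => ((((arcIndex n (p i) : ℝ) / 2 ^ n + t : ℝ)) :
      AddCircle (1 : ℝ)) with hu
    have hmem : ∀ t ∈ Ico (0 : ℝ) ((1 / 2) ^ n), u t ∈ cube n p := by
      rintro t ⟨ht0, ht⟩
      rw [mem_cube]
      intro i
      rw [hu, arcIndex_coe]
      refine Eq.trans ?_ (arcIndex_emod n (p i))
      congr 1
      rw [floor_mul_two_pow_eq_iff]
      rw [one_div_pow] at ht
      refine ⟨by linarith, by rw [add_div]; linarith⟩
    have := edist_le_ediam_of_mem (hmem δ ⟨hδ0, hδ⟩) (hmem 0 ⟨le_rfl, by positivity⟩)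
    refine le_trans ?_ this
    refine le_trans ?_ (edist_le_pi_edist _ _ ⟨0, hd⟩)
    rw [edist_dist, dist_eq_norm, hu, ← AddCircle.coe_sub]
    refine ENNReal.ofReal_le_ofReal ?_
    have h3 := (AddCircle.norm_coe_eq_abs_iff (1 : ℝ) (x := δ) one_ne_zero).2
      (by rw [abs_of_nonneg hδ0]; simpa using hδ')
    simp only [add_zero, add_sub_cancel_left, h3, le_abs_self]
  refine le_of_forall_lt_imp_le_of_dense fun c hc => ?_
  rw [← ENNReal.ofReal_toReal (hc.trans ENNReal.ofReal_lt_top).ne]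
  exact key _ ⟨ENNReal.toReal_nonneg, ENNReal.toReal_lt_of_lt_ofReal hc⟩

theorem measurable_arcIndex (n : ℕ) : Measurable (arcIndex n) := by
  have : Measurable fun a : AddCircle (1 : ℝ) => (AddCircle.equivIco 1 0 a : ℝ) :=
    measurable_subtype_coe.comp (AddCircle.measurableEquivIco (1 : ℝ) 0).measurable
  exact Int.measurable_floor.comp (this.mul_const _)

theorem measurableSet_cube {d : ℕ} (n : ℕ) (p : Torus d) : MeasurableSet (cube n p) :=
  MeasurableSet.univ_pi fun i => measurable_arcIndex n (measurableSet_singleton (arcIndex n (p i)))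

theorem volume_arc (n : ℕ) (a : AddCircle (1 : ℝ)) :
    volume {b | arcIndex n b = arcIndex n a} = ENNReal.ofReal ((1 / 2) ^ n) := by
  have h2 : (0 : ℝ) < 2 ^ n := by positivity
  have hmp := AddCircle.measurePreserving_mk (1 : ℝ) 0
  rw [zero_add, ← restrict_Ico_eq_restrict_Ioc] at hmp
  have hms : MeasurableSet {b | arcIndex n b = arcIndex n a} :=
    measurable_arcIndex n (measurableSet_singleton (arcIndex n a))
  rw [← hmp.measure_preimage hms.nullMeasurableSet,
    Measure.restrict_apply (hmp.measurable hms)]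
  obtain ⟨z, hz, rfl⟩ := exists_lift a
  set k := ⌊z * 2 ^ n⌋ with hk
  have hka : arcIndex n (z : AddCircle (1 : ℝ)) = k := by
    rw [arcIndex_coe, floor_mul_two_pow_mod hz]
  have hk0 : (0 : ℝ) ≤ k := by
    exact Int.cast_nonneg (Int.floor_nonneg.2 (mul_nonneg hz.1 h2.le))
  have hk1 : (k : ℝ) + 1 ≤ 2 ^ n := by
    have : k < 2 ^ n := by
      rw [hk, Int.floor_lt]; push_cast; nlinarith [hz.2]
    exact_mod_cast this
  have : (fun y : ℝ => (y : AddCircle (1 : ℝ))) ⁻¹'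
      {b | arcIndex n b = arcIndex n (z : AddCircle (1 : ℝ))} ∩ Ico 0 1 =
      Ico ((k : ℝ) / 2 ^ n) (((k : ℝ) + 1) / 2 ^ n) := by
    ext y
    rw [← floor_mul_two_pow_eq_iff, hka]
    constructor
    · rintro ⟨h1, h3⟩
      rwa [mem_preimage, mem_ofPred_eq, arcIndex_coe, floor_mul_two_pow_mod h3] at h1
    · intro h
      have hy : y ∈ Ico (0 : ℝ) 1 := by
        rw [floor_mul_two_pow_eq_iff] at h
        exact ⟨le_trans (by positivity) h.1, h.2.trans_le (by rwa [div_le_one h2])⟩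
      refine ⟨?_, hy⟩
      rw [mem_preimage, mem_ofPred_eq, arcIndex_coe, floor_mul_two_pow_mod hy]
      exact h
  erw [this]
  rw [Real.volume_Ico]
  congr 1
  rw [one_div_pow]
  ring

theorem volume_cube {d : ℕ} (n : ℕ) (p : Torus d) :
    volume (cube n p) = ENNReal.ofReal ((1 / 2) ^ n) ^ d := by
  rw [cube, volume_pi_pi]
  simp [volume_arc]

theorem volume_closedBall_le {d : ℕ} (p : Torus d) {r : ℝ} (hr : 0 ≤ r) :
    volume (closedBall p r) ≤ ENNReal.ofReal (2 * r) ^ d := by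
  rw [closedBall_pi _ hr, volume_pi_pi]
  refine (Finset.prod_le_prod' (g := fun _ => ENNReal.ofReal (2 * r)) fun i _ => ?_).trans_eq
    (by rw [Finset.prod_const, Finset.card_univ, Fintype.card_fin])
  · rw [AddCircle.volume_closedBall]
    exact ENNReal.ofReal_le_ofReal (min_le_right _ _)

theorem ae_cube_mem_nhds (d : ℕ) : ∀ᵐ p : Torus d, ∀ n, cube n p ∈ 𝓝 p := by
  set C : Set (AddCircle (1 : ℝ)) := range fun nk : ℕ × ℤ => (((nk.2 : ℝ) / 2 ^ nk.1 : ℝ) :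
    AddCircle (1 : ℝ)) with hC
  have hsing : NullSingletonClass (volume : Measure (AddCircle (1 : ℝ))) := ⟨fun a => by
    rw [← closedBall_zero, AddCircle.volume_closedBall]; simp⟩
  have hC0 : ∀ᵐ a : AddCircle (1 : ℝ), a ∉ C := (countable_range _).ae_notMem _
  have h : ∀ᵐ p : Torus d, ∀ i, p i ∉ C :=
    ae_all_iff.2 fun i => (Measure.quasiMeasurePreserving_eval
      (fun _ => (volume : Measure (AddCircle (1 : ℝ)))) i).ae hC0
  filter_upwards [h] with p hp n
  refine set_pi_mem_nhds Set.finite_univ fun i _ => ?_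
  obtain ⟨y, hy, hyp⟩ := exists_lift (p i)
  have hyI := (floor_mul_two_pow_eq_iff (n := n) (y := y)).1 rfl
  set k := ⌊y * 2 ^ n⌋ with hk
  have hne : (k : ℝ) / 2 ^ n ≠ y := fun h => hp i ⟨(n, k), by simp only [h, hyp]⟩
  have hopen := QuotientAddGroup.isOpenMap_coe (N := AddSubgroup.zmultiples (1 : ℝ))
    (Ioo ((k : ℝ) / 2 ^ n) (((k : ℝ) + 1) / 2 ^ n)) isOpen_Ioo
  refine mem_of_superset (hopen.mem_nhds (x := p i) ⟨y, ⟨lt_of_le_of_ne hyI.1 hne, hyI.2⟩, hyp⟩) ?_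
  rintro _ ⟨z, hz, rfl⟩
  have hz' := floor_mul_two_pow_eq_iff.2 (Ioo_subset_Ico_self hz)
  change arcIndex n (z : AddCircle (1 : ℝ)) = _
  rw [← hyp, arcIndex_coe, arcIndex_coe, hz']

theorem exists_closedBall_subset_cube {d : ℕ} (n : ℕ) (p : Torus d) :
    ∃ w : Torus d, closedBall w ((1 / 2) ^ (n + 2)) ⊆ cube n p := by
  have h2 : (0 : ℝ) < 2 ^ n := by positivity
  refine ⟨torusProj fun i => ((arcIndex n (p i) : ℝ) + 1 / 2) / 2 ^ n, fun q hq => ?_⟩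
  rw [mem_cube]
  intro i
  have hqi := (dist_le_pi_dist _ _ i).trans (mem_closedBall.1 hq)
  obtain ⟨y, hy, hyq⟩ := exists_lift (q i)
  set k := arcIndex n (p i) with hk
  set c : ℝ := ((k : ℝ) + 1 / 2) / 2 ^ n with hc
  have hqi' : |y - c - round (y - c)| ≤ (1 / 2) ^ (n + 2) := by
    rw [← UnitAddCircle.norm_eq]
    rw [dist_eq_norm, ← hyq] at hqi
    exact hqi
  set m := round (y - c)
  have hlift : ((y - m : ℝ) : AddCircle (1 : ℝ)) = q i := by
    have : ((m : ℝ) : AddCircle (1 : ℝ)) = 0 :=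
        (AddCircle.coe_eq_zero_iff (1 : ℝ)).2 ⟨m, by simp⟩
    rw [AddCircle.coe_sub, this, sub_zero, hyq]
  rw [← hlift, arcIndex_coe]
  refine Eq.trans ?_ (arcIndex_emod n (p i))
  congr 1
  rw [Int.floor_eq_iff]
  rw [abs_le] at hqi'
  have hc2 : c * 2 ^ n = k + 1 / 2 := by rw [hc]; field_simp
  have h4 : (1 / 2 : ℝ) ^ (n + 2) * 2 ^ n = 1 / 4 := by
    rw [pow_add, mul_right_comm, ← mul_pow]; norm_num
  constructor <;> nlinarith [mul_le_mul_of_nonneg_right hqi'.1 h2.le,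
    mul_le_mul_of_nonneg_right hqi'.2 h2.le]

theorem ediam_cube_pos {d : ℕ} (hd : 0 < d) (n : ℕ) (p : Torus d) : 0 < ediam (cube n p) :=
  calc 0 < ENNReal.ofReal ((1 / 2) ^ (n + 1)) := ENNReal.ofReal_pos.2 (by positivity)
    _ ≤ ediam (cube (n + 1) p) := le_ediam_cube hd (by lia) p
    _ ≤ ediam (cube n p) :=
      ediam_mono (cube_subset_cube n.le_succ (self_mem_cube _ _) (self_mem_cube _ _))

theorem ediam_cube_le_one {d : ℕ} (n : ℕ) (p : Torus d) : ediam (cube n p) ≤ 1 :=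
  (ediam_cube_le n p).trans (ENNReal.ofReal_le_one.2 (pow_le_one₀ (by norm_num) (by norm_num)))

theorem ediam_cube_ne_top {d : ℕ} (n : ℕ) (p : Torus d) : ediam (cube n p) ≠ ⊤ :=
  ((ediam_cube_le_one n p).trans_lt ENNReal.one_lt_top).ne

theorem volume_cube_le {d : ℕ} (hd : 0 < d) {n : ℕ} (hn : 1 ≤ n) (p : Torus d) (t : ℝ) :
    volume (cube n p) ≤ ediam (cube n p) ^ t * ediam (cube n p) ^ ((d : ℝ) - t) := by
  rw [← ENNReal.rpow_add _ _ (ediam_cube_pos hd n p).ne' (ediam_cube_ne_top n p),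
    add_sub_cancel, ENNReal.rpow_natCast, volume_cube]
  exact pow_le_pow_left' (le_ediam_cube hd hn p) d

theorem ediam_cube_pow_le_volume {d : ℕ} (hd : 0 < d) (n : ℕ) (p : Torus d) (t : ℝ) :
    ediam (cube n p) ^ t * ediam (cube n p) ^ ((d : ℝ) - t) ≤ volume (cube n p) := by
  rw [← ENNReal.rpow_add _ _ (ediam_cube_pos hd n p).ne' (ediam_cube_ne_top n p),
    add_sub_cancel, ENNReal.rpow_natCast, volume_cube]
  exact pow_le_pow_left' (ediam_cube_le n p) d

/-- The total `t`-weight of those members of a sequence of dyadic cubes that meet a given set. -/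
def meetingWeight {d : ℕ} (t : ℝ) (L : ℕ → ℕ) (c : ℕ → Torus d) (A : Set (Torus d)) : ℝ≥0∞ :=
  ∑' n, {n | (cube (L n) (c n) ∩ A).Nonempty}.indicator
    (fun n => ediam (cube (L n) (c n)) ^ t) n

theorem ediam_rpow_le_meetingWeight {d : ℕ} {t : ℝ} {L : ℕ → ℕ} {c : ℕ → Torus d}
    {A : Set (Torus d)} {n : ℕ} (hn : (cube (L n) (c n) ∩ A).Nonempty) :
    ediam (cube (L n) (c n)) ^ t ≤ meetingWeight t L c A := by
  refine le_trans ?_ (ENNReal.le_tsum n)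
  rw [indicator_of_mem (show n ∈ {n | (cube (L n) (c n) ∩ A).Nonempty} from hn)]

theorem lt_level_of_meetingWeight_lt {d : ℕ} {t : ℝ} (ht : 0 ≤ t) {L : ℕ → ℕ} {c : ℕ → Torus d}
    {m : ℕ} {w : Torus d} (hgood : meetingWeight t L c (cube m w) < ediam (cube m w) ^ t) {n : ℕ}
    (hn : (cube (L n) (c n) ∩ cube m w).Nonempty) : m < L n := by
  by_contra! h
  obtain ⟨z, hz1, hz2⟩ := hn
  have h1 := ENNReal.rpow_le_rpow (ediam_mono (cube_subset_cube h hz2 hz1)) ht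
  exact absurd (h1.trans (ediam_rpow_le_meetingWeight ⟨z, hz1, hz2⟩)) hgood.not_ge

theorem volume_cube_diff_pos {d : ℕ} (hd : 0 < d) {t : ℝ} (ht : 0 ≤ t) (htd : t ≤ d)
    {L : ℕ → ℕ} {c : ℕ → Torus d} {m : ℕ} {w : Torus d}
    (hgood : meetingWeight t L c (cube m w) < ediam (cube m w) ^ t) :
    0 < volume (cube m w \ ⋃ n, cube (L n) (c n)) := by
  by_contra! h0
  set S := {n | (cube (L n) (c n) ∩ cube m w).Nonempty}
  have hsub : cube m w ⊆ (cube m w \ ⋃ n, cube (L n) (c n)) ∪ ⋃ n ∈ S, cube (L n) (c n) := by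
    intro z hz
    by_cases hzn : ∃ n, z ∈ cube (L n) (c n)
    · obtain ⟨n, hn⟩ := hzn
      exact Or.inr (mem_biUnion (show n ∈ S from ⟨z, hn, hz⟩) hn)
    · exact Or.inl ⟨hz, by simpa using hzn⟩
  have hpos := ediam_cube_pos hd m w
  have htop := ediam_cube_ne_top m w
  have h1 : volume (cube m w) ≤ ∑' n, S.indicator (fun n => volume (cube (L n) (c n))) n :=
    calc volume (cube m w) ≤ volume (cube m w \ ⋃ n, cube (L n) (c n)) +
          volume (⋃ n ∈ S, cube (L n) (c n)) := (measure_mono hsub).trans (measure_union_le _ _)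
      _ ≤ 0 + ∑' n : S, volume (cube (L n) (c n)) :=
          add_le_add h0 (measure_biUnion_le _ (to_countable S) _)
      _ = _ := by rw [zero_add, ← tsum_subtype S fun n => volume (cube (L n) (c n))]
  have h2 : ∑' n, S.indicator (fun n => volume (cube (L n) (c n))) n ≤
      meetingWeight t L c (cube m w) * ediam (cube m w) ^ ((d : ℝ) - t) := by
    rw [meetingWeight, ← ENNReal.tsum_mul_right]
    refine ENNReal.tsum_le_tsum fun n => ?_
    by_cases hn : n ∈ S
    · have hlt := lt_level_of_meetingWeight_lt ht hgood hn
      rw [indicator_of_mem hn, indicator_of_mem hn]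
      refine (volume_cube_le hd (by lia) _ t).trans ?_
      obtain ⟨z, hz1, hz2⟩ := hn
      gcongr
      exact cube_subset_cube hlt.le hz1 hz2
    · rw [indicator_of_notMem hn]
      exact zero_le
  have hne0 : ediam (cube m w) ^ ((d : ℝ) - t) ≠ 0 := (ENNReal.rpow_pos hpos htop).ne'
  have hnetop : ediam (cube m w) ^ ((d : ℝ) - t) ≠ ⊤ :=
    ENNReal.rpow_ne_top_of_nonneg (by linarith) htop
  have h3 := (ENNReal.mul_lt_mul_iff_left hne0 hnetop).2 hgood
  exact absurd ((ediam_cube_pow_le_volume hd m w t).trans (h1.trans h2)) h3.not_ge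

theorem eventually_exists_levels {d : ℕ} {s t ε : ℝ} (ht : 0 < t) (hts : t < s)
    (hsd : s ≤ d) (hε : 0 < ε) (M : ℕ) : ∀ᶠ r : ℝ in 𝓝[>] 0, ∃ p q : ℕ, M ≤ p ∧ p ≤ q ∧
      (1 / 2) ^ p ≤ r ∧ r ≤ 2 * (1 / 2) ^ p ∧ (1 / 2) ^ q < r ^ ((d : ℝ) / s) ∧
      ENNReal.ofReal ((1 / 2) ^ p) ^ d ≤
        ENNReal.ofReal ε * ENNReal.ofReal ((1 / 2) ^ (q + 2)) ^ t := by
  have hs : 0 < s := ht.trans hts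
  have hd : (0 : ℝ) < d := hs.trans_le hsd
  have hα : 0 < (d : ℝ) - d / s * t := by
    have : (d : ℝ) / s * t < d := by
      rw [div_mul_eq_mul_div, div_lt_iff₀ hs]; exact mul_lt_mul_of_pos_left hts hd
    linarith
  have hlim : Tendsto (fun r : ℝ => r ^ ((d : ℝ) - d / s * t) * 8 ^ t) (𝓝[>] 0) (𝓝 0) := by
    have := (Real.continuousAt_rpow_const 0 ((d : ℝ) - d / s * t) (Or.inr hα.le)).tendsto
    rw [Real.zero_rpow hα.ne'] at this
    simpa using (this.mono_left nhdsWithin_le_nhds).mul_const ((8 : ℝ) ^ t)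
  have hM : ∀ᶠ r : ℝ in 𝓝[>] 0, r < (1 / 2) ^ M :=
    nhdsWithin_le_nhds (Iio_mem_nhds (by positivity))
  filter_upwards [hlim.eventually (Iio_mem_nhds hε), hM, self_mem_nhdsWithin] with r hrε hrM hr0
  have hr0 : 0 < r := hr0
  have hr1 : r < 1 := hrM.trans_le (pow_le_one₀ (by norm_num) (by norm_num))
  have hρ0 : 0 < r ^ ((d : ℝ) / s) := Real.rpow_pos_of_pos hr0 _
  have hρr : r ^ ((d : ℝ) / s) ≤ r := by
    simpa using Real.rpow_le_rpow_of_exponent_ge hr0 hr1.le ((one_le_div hs).2 hsd)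
  obtain ⟨p, hp1, hp2⟩ := exists_nat_pow_near_of_lt_one hr0 hr1.le
    (by norm_num : (0 : ℝ) < 1 / 2) (by norm_num)
  obtain ⟨q, hq1, hq2⟩ := exists_nat_pow_near_of_lt_one hρ0 (hρr.trans hr1.le)
    (by norm_num : (0 : ℝ) < 1 / 2) (by norm_num)
  have hlt : ∀ {a b : ℕ}, (1 / 2 : ℝ) ^ a < (1 / 2) ^ b → b < a := fun h =>
    (pow_lt_pow_iff_right_of_lt_one₀ (by norm_num) (by norm_num)).1 h
  refine ⟨p + 1, q + 1, (hlt (hp1.trans hrM)).le, ?_, hp1.le, ?_, hq1, ?_⟩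
  · have := hlt (hq1.trans_le (hρr.trans hp2))
    lia
  · rw [pow_succ]; linarith
  · rw [← ENNReal.ofReal_pow (by positivity), ENNReal.ofReal_rpow_of_pos (by positivity),
      ← ENNReal.ofReal_mul hε.le]
    refine ENNReal.ofReal_le_ofReal ?_
    calc ((1 / 2 : ℝ) ^ (p + 1)) ^ d ≤ r ^ d := by gcongr
      _ = r ^ ((d : ℝ) - d / s * t) * (r ^ ((d : ℝ) / s)) ^ t := by
        rw [← Real.rpow_mul hr0.le, ← Real.rpow_add hr0, sub_add_cancel, Real.rpow_natCast]
      _ ≤ r ^ ((d : ℝ) - d / s * t) * (8 * (1 / 2) ^ (q + 1 + 2)) ^ t := by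
        gcongr
        refine hq2.trans_eq ?_
        rw [pow_add, pow_add]; ring
      _ = r ^ ((d : ℝ) - d / s * t) * 8 ^ t * ((1 / 2) ^ (q + 1 + 2)) ^ t := by
        rw [Real.mul_rpow (by norm_num) (by positivity), mul_assoc]
      _ ≤ ε * ((1 / 2) ^ (q + 1 + 2)) ^ t := by
        gcongr

theorem exists_good_subcube {d : ℕ} (hd : 0 < d) {x : ℕ → Torus d} {r : ℕ → ℝ}
    (hr : ∀ j, 0 < r j) (hrlim : Tendsto r atTop (𝓝 0))
    (hfull : volume ((⋂ k, ⋃ j, ⋃ (_ : k ≤ j), ball (x j) (r j))ᶜ) = 0)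
    {s t : ℝ} (ht : 0 < t) (hts : t < s) (hsd : s ≤ d) {L : ℕ → ℕ} {c : ℕ → Torus d}
    (hT : ∑' n, ediam (cube (L n) (c n)) ^ t ≤ 1) {m : ℕ} {w : Torus d}
    (hgood : meetingWeight t L c (cube m w) < ediam (cube m w) ^ t) (N : ℕ) :
    ∃ m' w', m < m' ∧ closedBall w' ((1 / 2) ^ m') ⊆ cube m w ∧
      (∃ j, N ≤ j ∧ closedBall w' ((1 / 2) ^ m') ⊆ ball (x j) (r j ^ ((d : ℝ) / s))) ∧
      meetingWeight t L c (cube m' w') < ediam (cube m' w') ^ t := by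
  have htd : 0 < (d : ℝ) - t := by linarith
  set V := cube m w \ ⋃ n, cube (L n) (c n)
  have hVpos : 0 < volume V := volume_cube_diff_pos hd ht.le (by linarith) hgood
  obtain ⟨e, he0, heV⟩ := ENNReal.lt_iff_exists_nnreal_btwn.1 hVpos
  have he0 : 0 < e := by exact_mod_cast he0
  set ε : ℝ := e / (2 * 20 ^ d) with hε
  have hε0 : 0 < ε := by positivity
  obtain ⟨M, hMm, hMε⟩ : ∃ M, m ≤ M ∧ ENNReal.ofReal ((1 / 2) ^ M) ^ ((d : ℝ) - t) ≤
      ENNReal.ofReal ε := by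
    have h1 : Tendsto (fun M : ℕ => ENNReal.ofReal ((1 / 2) ^ M) ^ ((d : ℝ) - t)) atTop (𝓝 0) := by
      have h2 := (ENNReal.tendsto_ofReal (tendsto_pow_atTop_nhds_zero_of_lt_one
        (by norm_num : (0 : ℝ) ≤ 1 / 2) (by norm_num))).ennrpow_const ((d : ℝ) - t)
      rwa [ENNReal.ofReal_zero, ENNReal.zero_rpow_of_pos htd] at h2
    have h3 := h1.eventually (Iio_mem_nhds (ENNReal.ofReal_pos.2 hε0))
    obtain ⟨M, hM1, hM2⟩ := ((eventually_ge_atTop m).and h3).exists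
    exact ⟨M, hM1, le_of_lt hM2⟩
  have hr0 : Tendsto r atTop (𝓝[>] 0) :=
    tendsto_nhdsWithin_iff.2 ⟨hrlim, Eventually.of_forall hr⟩
  obtain ⟨N₀, hN₀⟩ := eventually_atTop.1
    (hr0.eventually (eventually_exists_levels ht hts hsd hε0 M))
  choose! p q hMp hpq hpr hrp hqr hvol using hN₀
  set J := {j | N ≤ j ∧ N₀ ≤ j ∧ ∃ y ∈ V, x j ∈ cube M y}
  choose v hv using fun j => exists_closedBall_subset_cube (q j) (x j)
  have hvx : ∀ j, v j ∈ cube (q j) (x j) := fun j => hv j (mem_closedBall_self (by positivity))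
  by_contra! hbad
  have hbadJ : ∀ j ∈ J, ediam (cube (q j + 2) (v j)) ^ t ≤
      meetingWeight t L c (cube (q j + 2) (v j)) := by
    rintro j ⟨hNj, hN₀j, y, hyV, hxy⟩
    have hMq := (hMp j hN₀j).trans (hpq j hN₀j)
    refine hbad (q j + 2) (v j) (by lia) ?_ ⟨j, hNj, ?_⟩
    · refine (hv j).trans ((cube_subset_cube hMq (self_mem_cube _ _) hxy).trans ?_)
      exact cube_subset_cube hMm (self_mem_cube _ _) hyV.1
    · intro z hz
      exact mem_ball.2 ((dist_le_of_mem_cube (hv j hz)).trans_lt (hqr j hN₀j))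
  obtain ⟨u, huJ, hudisj, hucov⟩ := Vitali.exists_disjoint_subfamily_covering_enlargement_closedBall
    J x r 2 (fun j hj => (hrp j hj.2.1).trans (by
      have : (1 / 2 : ℝ) ^ p j ≤ 1 := pow_le_one₀ (by norm_num) (by norm_num)
      linarith)) 5 (by norm_num)
  have hPB : ∀ j ∈ u, cube (p j) (x j) ⊆ closedBall (x j) (r j) := fun j hj z hz =>
    mem_closedBall.2 ((dist_le_of_mem_cube hz).trans (hpr j (huJ hj).2.1))
  have hPdisj : Pairwise (Function.onFun Disjoint fun j : u => cube (p j) (x j)) := by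
    intro i j hij
    exact (hudisj i.2 j.2 (fun h => hij (Subtype.ext h))).mono (hPB i i.2) (hPB j j.2)
  have hcover : volume V ≤ volume (⋃ j ∈ u, closedBall (x j) (5 * r j)) := by
    refine measure_mono_ae ?_
    filter_upwards [ae_cube_mem_nhds d, (mem_ae_iff.2 hfull :
      (⋂ k, ⋃ j, ⋃ (_ : k ≤ j), ball (x j) (r j)) ∈ ae volume)] with y hy1 hy2 hyV
    obtain ⟨δ, hδ, hball⟩ := Metric.mem_nhds_iff.1 (hy1 M)
    obtain ⟨K, hK⟩ := eventually_atTop.1 (hrlim.eventually (Iio_mem_nhds hδ))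
    simp only [mem_iInter, mem_iUnion] at hy2
    obtain ⟨j, hj, hyj⟩ := hy2 (max K (max N N₀))
    have hjJ : j ∈ J := by
      refine ⟨by lia, by lia, y, hyV, hball ?_⟩
      rw [mem_ball, dist_comm]
      exact (mem_ball.1 hyj).trans (hK j (by lia))
    obtain ⟨b, hb, hsub⟩ := hucov j hjJ
    exact mem_biUnion hb (hsub (ball_subset_closedBall hyj))
  have hball : ∀ j ∈ u, volume (closedBall (x j) (5 * r j)) ≤
      ENNReal.ofReal 20 ^ d * volume (cube (p j) (x j)) := by
    intro j hj
    refine (volume_closedBall_le _ (by linarith [hr j])).trans ?_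
    rw [volume_cube, ← mul_pow, ← ENNReal.ofReal_mul (by norm_num)]
    refine pow_le_pow_left' (ENNReal.ofReal_le_ofReal ?_) d
    linarith [hrp j (huJ hj).2.1]
  set F := ⋃ n ∈ {n | M < L n}, cube (L n) (c n)
  have hFvol : volume F ≤ ENNReal.ofReal ε := by
    calc volume F ≤ ∑' n : {n | M < L n}, volume (cube (L n) (c n)) :=
          measure_biUnion_le _ (to_countable _) _
      _ ≤ ∑' n : {n | M < L n}, ediam (cube (L n) (c n)) ^ t * ENNReal.ofReal ε := by
          refine ENNReal.tsum_le_tsum fun ⟨n, hn⟩ => ?_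
          have hn : M < L n := hn
          refine (volume_cube_le hd (by lia) _ t).trans ?_
          gcongr
          refine le_trans (ENNReal.rpow_le_rpow ((ediam_cube_le _ _).trans ?_) htd.le) hMε
          exact ENNReal.ofReal_le_ofReal (pow_le_pow_of_le_one (by norm_num) (by norm_num) hn.le)
      _ ≤ ∑' n, ediam (cube (L n) (c n)) ^ t * ENNReal.ofReal ε :=
          ENNReal.tsum_comp_le_tsum_of_injective Subtype.val_injective
            fun n => ediam (cube (L n) (c n)) ^ t * ENNReal.ofReal ε
      _ ≤ ENNReal.ofReal ε := by
          rw [ENNReal.tsum_mul_right]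
          exact mul_le_of_le_one_left zero_le hT
  set g : ℕ → ℕ → ℝ≥0∞ := fun j => {n | cube (L n) (c n) ⊆ cube (p j) (x j)}.indicator
    (fun n => ediam (cube (L n) (c n)) ^ t) with hg
  have hPvol : ∀ j ∈ u, volume (cube (p j) (x j)) ≤
      volume.restrict F (cube (p j) (x j)) + ENNReal.ofReal ε * ∑' n, g j n := by
    intro j hj
    obtain ⟨hNj, hN₀j, y, hyV, hxy⟩ := huJ hj
    have hPM : cube (p j) (x j) ⊆ cube M y :=
      cube_subset_cube (hMp j hN₀j) (self_mem_cube _ _) hxy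
    by_cases hA : ∃ n, cube (p j) (x j) ⊆ cube (L n) (c n)
    · obtain ⟨n, hn⟩ := hA
      have hMn : M < L n := by
        by_contra! hle
        have h1 := cube_subset_cube hle (hPM (self_mem_cube _ _)) (hn (self_mem_cube _ _))
        exact hyV.2 (mem_iUnion.2 ⟨n, h1 (self_mem_cube _ _)⟩)
      rw [Measure.restrict_apply (measurableSet_cube _ _), inter_eq_left.2
        (hn.trans (subset_biUnion_of_mem (u := fun n => cube (L n) (c n))
          (show n ∈ {n | M < L n} from hMn)))]
      exact le_self_add
    · refine le_trans ?_ le_add_self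
      rw [volume_cube]
      refine (hvol j hN₀j).trans ?_
      gcongr
      refine (ENNReal.rpow_le_rpow (le_ediam_cube hd (by lia) (v j)) ht.le).trans
        ((hbadJ j (huJ hj)).trans ?_)
      refine ENNReal.tsum_le_tsum fun n => ?_
      refine indicator_le_indicator_of_subset ?_ (fun _ => zero_le) n
      rintro n ⟨z, hz1, hz2⟩
      have hzq : z ∈ cube (p j) (x j) :=
        cube_subset_cube (hpq j hN₀j) (self_mem_cube _ _) (self_mem_cube _ _)
          (cube_subset_cube (by lia) (self_mem_cube _ _) (hvx j) hz2)
      rcases le_total (L n) (p j) with h | h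
      · exact absurd ⟨n, cube_subset_cube h hzq hz1⟩ hA
      · exact cube_subset_cube h hz1 hzq
  have hgsum : ∑' j : u, ∑' n, g j n ≤ 1 := by
    rw [ENNReal.tsum_comm]
    refine (ENNReal.tsum_le_tsum fun n => ?_).trans hT
    by_cases hj : ∃ j : u, cube (L n) (c n) ⊆ cube (p j) (x j)
    · obtain ⟨j, hj⟩ := hj
      rw [tsum_eq_single j]
      · exact indicator_le_self' (fun _ _ => zero_le) n
      · intro i hij
        refine indicator_of_notMem (fun hi => ?_) _
        exact (hPdisj hij).le_bot ⟨hi (self_mem_cube _ _), hj (self_mem_cube _ _)⟩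
    · push Not at hj
      rw [ENNReal.tsum_eq_zero.2]
      · exact zero_le
      · exact fun i => indicator_of_notMem (hj i) _
  have hFsum : ∑' j : u, volume.restrict F (cube (p j) (x j)) ≤ ENNReal.ofReal ε := by
    refine (tsum_measure_le_measure_univ (fun j => (measurableSet_cube _ _).nullMeasurableSet)
      fun i j hij => (hPdisj hij).aedisjoint).trans ?_
    rwa [Measure.restrict_apply_univ]
  refine absurd heV (not_lt.2 ?_)
  calc volume V ≤ ∑' j : u, volume (closedBall (x j) (5 * r j)) :=
        hcover.trans (measure_biUnion_le _ (to_countable u) _)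
    _ ≤ ∑' j : u, ENNReal.ofReal 20 ^ d * volume (cube (p j) (x j)) :=
        ENNReal.tsum_le_tsum fun j => hball j j.2
    _ ≤ ENNReal.ofReal 20 ^ d * ∑' j : u, (volume.restrict F (cube (p j) (x j)) +
          ENNReal.ofReal ε * ∑' n, g j n) := by
        rw [ENNReal.tsum_mul_left]
        gcongr with j
        exact hPvol j j.2
    _ ≤ ENNReal.ofReal 20 ^ d * (ENNReal.ofReal ε + ENNReal.ofReal ε) := by
        rw [ENNReal.tsum_add, ENNReal.tsum_mul_left]
        gcongr
        exact mul_le_of_le_one_right zero_le hgsum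
    _ = e := by
        rw [← ENNReal.ofReal_add hε0.le hε0.le, ← ENNReal.ofReal_pow (by norm_num),
          ← ENNReal.ofReal_mul (by positivity), ← ENNReal.ofReal_coe_nnreal]
        congr 1
        rw [hε]
        field_simp
        ring

/-- **Corollary (classical mass transference principle), large intersection part.**
If `limsup B(x_j, r_j)` has full Lebesgue measure in the torus and `0 ≤ s ≤ d`, then
`limsup B(x_j, r_j^{d/s}) ∈ 𝒢^s(𝕋^d)`. -/
theorem mass_transference_balls_largeIntersection
    (d : ℕ) (hd : 0 < d)
    (x : ℕ → Torus d) (r : ℕ → ℝ) (hr : ∀ j, 0 < r j)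
    (hrlim : Tendsto r atTop (𝓝 0))
    (hfull : volume ((⋂ k, ⋃ j, ⋃ (_ : k ≤ j), ball (x j) (r j))ᶜ) = 0)
    (s : ℝ) (hs0 : 0 ≤ s) (hsd : s ≤ d) :
    MemLargeIntersectionClass s
      (⋂ k, ⋃ j, ⋃ (_ : k ≤ j), ball (x j) (r j ^ ((d : ℝ) / s))) := by
  refine ⟨IsGδ.iInter_of_isOpen fun k => isOpen_iUnion fun j => isOpen_iUnion fun _ => isOpen_ball,
    fun D hD t hts => ?_⟩
  obtain ⟨m₀, w₀, rfl⟩ := hD.exists_eq_cube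
  refine le_iInf fun f => le_iInf fun hf => le_iInf fun hcov => ?_
  choose L c hfc using fun n => (hf n).exists_eq_cube
  obtain rfl : f = fun n => cube (L n) (c n) := funext hfc
  change ediam (cube m₀ w₀) ^ t ≤ ∑' n, ediam (cube (L n) (c n)) ^ t
  rcases le_or_gt t 0 with ht | ht
  · have h1 : ∀ n, 1 ≤ ediam (cube (L n) (c n)) ^ t := fun n =>
      ht.lt_or_eq.elim (ENNReal.one_le_rpow_of_pos_of_le_one_of_neg (ediam_cube_pos hd _ _)
        (ediam_cube_le_one _ _)) fun h => by rw [h, ENNReal.rpow_zero]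
    have h2 : ∑' _ : ℕ, (1 : ℝ≥0∞) = ⊤ := ENNReal.tsum_const_eq_top_of_ne_zero one_ne_zero
    exact le_top.trans (h2.ge.trans (ENNReal.tsum_le_tsum h1))
  by_contra! hlt
  have hT : ∑' n, ediam (cube (L n) (c n)) ^ t ≤ 1 :=
    hlt.le.trans (ENNReal.rpow_le_one (ediam_cube_le_one _ _) ht.le)
  have hgood₀ : meetingWeight t L c (cube m₀ w₀) < ediam (cube m₀ w₀) ^ t :=
    lt_of_le_of_lt (ENNReal.tsum_le_tsum fun n => indicator_le_self' (fun _ _ => zero_le) n) hlt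
  choose! lev pt hlev hsub hball hgood using fun (N m : ℕ) (w : Torus d)
    (h : meetingWeight t L c (cube m w) < ediam (cube m w) ^ t) =>
      exists_good_subcube hd hr hrlim hfull ht hts hsd hT h N
  let Q : ℕ → ℕ × Torus d := fun k =>
    Nat.rec (m₀, w₀) (fun N P => (lev N P.1 P.2, pt N P.1 P.2)) k
  have hQ : ∀ k, meetingWeight t L c (cube (Q k).1 (Q k).2) < ediam (cube (Q k).1 (Q k).2) ^ t := by
    intro k
    induction k with
    | zero => exact hgood₀
    | succ k ih => exact hgood k _ _ ih
  have hQlev : ∀ k, k ≤ (Q k).1 := by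
    intro k
    induction k with
    | zero => exact Nat.zero_le _
    | succ k ih => exact ih.trans_lt (hlev k _ _ (hQ k))
  let B : ℕ → Set (Torus d) := fun k => closedBall (Q (k + 1)).2 ((1 / 2) ^ (Q (k + 1)).1)
  have hBQ : ∀ k, B k ⊆ cube (Q k).1 (Q k).2 := fun k => hsub k _ _ (hQ k)
  obtain ⟨z, hz⟩ := IsCompact.nonempty_iInter_of_sequence_nonempty_isCompact_isClosed B
    (fun k => (hBQ (k + 1)).trans fun z hz => mem_closedBall.2 (dist_le_of_mem_cube hz))
    (fun k => ⟨_, mem_closedBall_self (by positivity)⟩)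
    (isCompact_closedBall _ _) (fun k => isClosed_closedBall)
  rw [mem_iInter] at hz
  have hzE : z ∈ ⋂ k, ⋃ j, ⋃ (_ : k ≤ j), ball (x j) (r j ^ ((d : ℝ) / s)) := by
    simp only [mem_iInter, mem_iUnion]
    intro k
    obtain ⟨j, hj, hjB⟩ := hball k _ _ (hQ k)
    exact ⟨j, hj, hjB (hz k)⟩
  obtain ⟨n, hn⟩ := mem_iUnion.1 (hcov ⟨hzE, hBQ 0 (hz 0)⟩)
  have h1 := lt_level_of_meetingWeight_lt ht.le (hQ (L n)) ⟨z, hn, hBQ _ (hz (L n))⟩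
  exact absurd (hQlev (L n)) h1.not_ge
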